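/- Let u : ℝ⁴ → ℝ be smooth with coordinates (x,y,z,t). For λ ∈ ℝ define T f = f_t + (u_{xy} − λ) f_x − u_{xx} f_y and Z f = λ f_z − u_{yz} f_x + u_{zx} f_y on smooth functions f. Then T and Z commute (T(Zf) = Z(Tf) for every smooth f) for every λ ∈ ℝ if and only if ∂_x M = 0 and ∂_y M = 0, where M = u_{zt} + u_{zx} u_{xy} − u_{yz} u_{xx}. In particular, if u satisfies the Doubrov–Ferapontov modified heavenly equation M = 0, then T and Z commute for every λ ∈ ℝ. -/

import Mathlib

/-- Partial derivative of `f` in the `i`-th coordinate direction. -/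
noncomputable def pd {n : ℕ} (i : Fin n) (f : (Fin n → ℝ) → ℝ) : (Fin n → ℝ) → ℝ :=
  fun p => fderiv ℝ f p (Pi.single i 1)

/-- Coordinates: x = 0, y = 1, z = 2, t = 3.
`T f = f_t + (u_{xy} − λ) f_x − u_{xx} f_y`. -/
noncomputable def Tlax (u : (Fin 4 → ℝ) → ℝ) (lam : ℝ) (f : (Fin 4 → ℝ) → ℝ) :
    (Fin 4 → ℝ) → ℝ :=
  fun q => pd 3 f q + (pd 0 (pd 1 u) q - lam) * pd 0 f q - pd 0 (pd 0 u) q * pd 1 f q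

/-- `Z f = λ f_z − u_{yz} f_x + u_{zx} f_y`. -/
noncomputable def Zlax (u : (Fin 4 → ℝ) → ℝ) (lam : ℝ) (f : (Fin 4 → ℝ) → ℝ) :
    (Fin 4 → ℝ) → ℝ :=
  fun q => lam * pd 2 f q - pd 1 (pd 2 u) q * pd 0 f q + pd 0 (pd 2 u) q * pd 1 f q

/-- `M = u_{zt} + u_{zx} u_{xy} − u_{yz} u_{xx}`. -/
noncomputable def Mheav (u : (Fin 4 → ℝ) → ℝ) : (Fin 4 → ℝ) → ℝ :=
  fun q => pd 2 (pd 3 u) q + pd 0 (pd 2 u) q * pd 0 (pd 1 u) q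
    - pd 1 (pd 2 u) q * pd 0 (pd 0 u) q

section PartialDerivatives

variable {n : ℕ} {f g : (Fin n → ℝ) → ℝ}

theorem contDiff_pd (hf : ContDiff ℝ (⊤ : ℕ∞) f) (i : Fin n) :
    ContDiff ℝ (⊤ : ℕ∞) (pd i f) :=
  (hf.fderiv_right (m := (⊤ : ℕ∞)) (by simp)).clm_apply contDiff_const

theorem pd_comm (hf : ContDiff ℝ (⊤ : ℕ∞) f) (i j : Fin n) :
    pd i (pd j f) = pd j (pd i f) := by
  have hd : Differentiable ℝ (fderiv ℝ f) :=
    (hf.fderiv_right (m := (⊤ : ℕ∞)) (by simp)).differentiable (by simp)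
  have key (i j : Fin n) (q : Fin n → ℝ) :
      pd i (pd j f) q = fderiv ℝ (fderiv ℝ f) q (Pi.single i 1) (Pi.single j 1) := by
    have h := ((hd q).hasFDerivAt.clm_apply
      (hasFDerivAt_const (Pi.single j (1 : ℝ) : Fin n → ℝ) q)).fderiv
    change fderiv ℝ (fun p => fderiv ℝ f p (Pi.single j 1)) q (Pi.single i 1) = _
    rw [h]
    simp
  funext q
  rw [key, key]
  exact (hf.contDiffAt.isSymmSndFDerivAt (by
    rw [minSmoothness_of_isRCLikeNormedField]
    exact WithTop.coe_le_coe.2 (le_top : (2 : ℕ∞) ≤ ⊤))).eq _ _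

theorem pd_add (hf : Differentiable ℝ f) (hg : Differentiable ℝ g) (i : Fin n)
    (q : Fin n → ℝ) : pd i (fun p => f p + g p) q = pd i f q + pd i g q := by
  simp only [pd]
  rw [fderiv_fun_add (hf q) (hg q), add_apply]

theorem pd_sub (hf : Differentiable ℝ f) (hg : Differentiable ℝ g) (i : Fin n)
    (q : Fin n → ℝ) : pd i (fun p => f p - g p) q = pd i f q - pd i g q := by
  simp only [pd]
  rw [fderiv_fun_sub (hf q) (hg q), sub_apply]

theorem pd_mul (hf : Differentiable ℝ f) (hg : Differentiable ℝ g) (i : Fin n)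
    (q : Fin n → ℝ) : pd i (fun p => f p * g p) q = f q * pd i g q + g q * pd i f q := by
  simp only [pd]
  rw [fderiv_fun_mul (hf q) (hg q)]
  simp

theorem pd_const (c : ℝ) (i : Fin n) (q : Fin n → ℝ) : pd i (fun _ => c) q = 0 := by
  simp [pd]

theorem pd_coord (i j : Fin n) (q : Fin n → ℝ) :
    pd i (fun p => p j) q = if j = i then 1 else 0 := by
  simp only [pd]
  rw [(hasFDerivAt_apply j q).fderiv]
  simp [Pi.single_apply]

end PartialDerivatives

/-- The commutator of the Lax pair is the vector field `M_x ∂_y - M_y ∂_x`. -/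
theorem Tlax_Zlax_sub_Zlax_Tlax {u f : (Fin 4 → ℝ) → ℝ} (hu : ContDiff ℝ (⊤ : ℕ∞) u)
    (hf : ContDiff ℝ (⊤ : ℕ∞) f) (lam : ℝ) (q : Fin 4 → ℝ) :
    Tlax u lam (Zlax u lam f) q - Zlax u lam (Tlax u lam f) q
      = pd 0 (Mheav u) q * pd 1 f q - pd 1 (Mheav u) q * pd 0 f q := by
  have d1 {g : (Fin 4 → ℝ) → ℝ} (hg : ContDiff ℝ (⊤ : ℕ∞) g) (i : Fin 4) :
      Differentiable ℝ (pd i g) := (contDiff_pd hg i).differentiable (by simp)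
  have du (i j : Fin 4) : Differentiable ℝ (pd i (pd j u)) := d1 (contDiff_pd hu j) i
  have df := d1 hf
  have hZ (i : Fin 4) : pd i (Zlax u lam f) q =
      lam * pd i (pd 2 f) q
      - (pd 1 (pd 2 u) q * pd i (pd 0 f) q + pd 0 f q * pd i (pd 1 (pd 2 u)) q)
      + (pd 0 (pd 2 u) q * pd i (pd 1 f) q + pd 1 f q * pd i (pd 0 (pd 2 u)) q) := by
    have hc : Differentiable ℝ fun _ : Fin 4 → ℝ => lam := differentiable_const _
    unfold Zlax
    rw [pd_add ((hc.fun_mul (df 2)).fun_sub ((du 1 2).fun_mul (df 0)))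
        ((du 0 2).fun_mul (df 1)),
      pd_sub (hc.fun_mul (df 2)) ((du 1 2).fun_mul (df 0)), pd_mul hc (df 2),
      pd_mul (du 1 2) (df 0), pd_mul (du 0 2) (df 1), pd_const]
    ring
  have hT (i : Fin 4) : pd i (Tlax u lam f) q =
      pd i (pd 3 f) q
      + ((pd 0 (pd 1 u) q - lam) * pd i (pd 0 f) q + pd 0 f q * pd i (pd 0 (pd 1 u)) q)
      - (pd 0 (pd 0 u) q * pd i (pd 1 f) q + pd 1 f q * pd i (pd 0 (pd 0 u)) q) := by
    have hc : Differentiable ℝ fun _ : Fin 4 → ℝ => lam := differentiable_const _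
    have ha := (du 0 1).fun_sub hc
    unfold Tlax
    rw [pd_sub ((df 3).fun_add (ha.fun_mul (df 0))) ((du 0 0).fun_mul (df 1)),
      pd_add (df 3) (ha.fun_mul (df 0)), pd_mul ha (df 0), pd_sub (du 0 1) hc,
      pd_mul (du 0 0) (df 1), pd_const]
    ring
  have hM (i : Fin 4) : pd i (Mheav u) q =
      pd i (pd 2 (pd 3 u)) q
      + (pd 0 (pd 2 u) q * pd i (pd 0 (pd 1 u)) q + pd 0 (pd 1 u) q * pd i (pd 0 (pd 2 u)) q)
      - (pd 1 (pd 2 u) q * pd i (pd 0 (pd 0 u)) q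
        + pd 0 (pd 0 u) q * pd i (pd 1 (pd 2 u)) q) := by
    unfold Mheav
    rw [pd_sub ((du 2 3).fun_add ((du 0 2).fun_mul (du 0 1))) ((du 1 2).fun_mul (du 0 0)),
      pd_add (du 2 3) ((du 0 2).fun_mul (du 0 1)), pd_mul (du 0 2) (du 0 1),
      pd_mul (du 1 2) (du 0 0)]
  have c10 {g : (Fin 4 → ℝ) → ℝ} (hg : ContDiff ℝ (⊤ : ℕ∞) g) := pd_comm hg 1 0
  have c20 {g : (Fin 4 → ℝ) → ℝ} (hg : ContDiff ℝ (⊤ : ℕ∞) g) := pd_comm hg 2 0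
  have c30 {g : (Fin 4 → ℝ) → ℝ} (hg : ContDiff ℝ (⊤ : ℕ∞) g) := pd_comm hg 3 0
  have c21 {g : (Fin 4 → ℝ) → ℝ} (hg : ContDiff ℝ (⊤ : ℕ∞) g) := pd_comm hg 2 1
  have c31 {g : (Fin 4 → ℝ) → ℝ} (hg : ContDiff ℝ (⊤ : ℕ∞) g) := pd_comm hg 3 1
  have c32 {g : (Fin 4 → ℝ) → ℝ} (hg : ContDiff ℝ (⊤ : ℕ∞) g) := pd_comm hg 3 2
  rw [Tlax, Zlax, hM, hM]
  simp only [hZ, hT, c10, c20, c30, c21, c31, c32, contDiff_pd, hu, hf]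
  ring

/-- `T` and `Z` commute on smooth functions for every `λ` iff
`∂_x M = 0` and `∂_y M = 0`; in particular they commute whenever `M = 0`. -/
theorem stmt1 (u : (Fin 4 → ℝ) → ℝ) (hu : ContDiff ℝ (⊤ : ℕ∞) u) :
    ((∀ lam : ℝ, ∀ f : (Fin 4 → ℝ) → ℝ, ContDiff ℝ (⊤ : ℕ∞) f → ∀ q,
        Tlax u lam (Zlax u lam f) q = Zlax u lam (Tlax u lam f) q)
      ↔ (∀ q, pd 0 (Mheav u) q = 0 ∧ pd 1 (Mheav u) q = 0))
    ∧ ((∀ q, Mheav u q = 0) →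
        ∀ lam : ℝ, ∀ f : (Fin 4 → ℝ) → ℝ, ContDiff ℝ (⊤ : ℕ∞) f → ∀ q,
          Tlax u lam (Zlax u lam f) q = Zlax u lam (Tlax u lam f) q) := by
  have comm_of_pd (hM : ∀ q, pd 0 (Mheav u) q = 0 ∧ pd 1 (Mheav u) q = 0) (lam : ℝ)
      (f : (Fin 4 → ℝ) → ℝ) (hf : ContDiff ℝ (⊤ : ℕ∞) f) (q : Fin 4 → ℝ) :
      Tlax u lam (Zlax u lam f) q = Zlax u lam (Tlax u lam f) q := by
    rw [← sub_eq_zero, Tlax_Zlax_sub_Zlax_Tlax hu hf, (hM q).1, (hM q).2]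
    ring
  refine ⟨⟨fun h q => ?_, comm_of_pd⟩, fun h => comm_of_pd fun q => ?_⟩
  · have hcoord (j : Fin 4) :
        pd 0 (Mheav u) q * pd 1 (fun p => p j) q - pd 1 (Mheav u) q * pd 0 (fun p => p j) q
          = 0 := by
      have hj : ContDiff ℝ (⊤ : ℕ∞) fun p : Fin 4 → ℝ => p j := contDiff_apply ℝ ℝ j
      rw [← Tlax_Zlax_sub_Zlax_Tlax hu hj 0, h 0 _ hj, sub_self]
    have h0 := hcoord 0
    have h1 := hcoord 1
    simp only [pd_coord] at h0 h1
    exact ⟨by simpa using h1, by simpa using h0⟩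
  · rw [show Mheav u = fun _ => 0 from funext h]
    exact ⟨pd_const 0 0 q, pd_const 0 1 q⟩
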